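/- Let p ≥ -1 be a real number and let Ω ⊂ ℝ² be a bounded open connected set with piecewise C¹ boundary such that 0 ∈ Ω. Then (|Ω|/π)^((p+1)/2) ≤ (1/(2π)) ∫_{∂Ω} |x|^p dσ(x). -/

import Mathlib

open MeasureTheory Metric Real

/-- `Ω ⊂ ℝ²` has piecewise `C¹` boundary: its topological boundary is a finite
union of images of `C¹` curves. -/
def HasPiecewiseC1Boundary (Ω : Set (EuclideanSpace ℝ (Fin 2))) : Prop :=
  ∃ (n : ℕ) (γ : Fin n → ℝ → EuclideanSpace ℝ (Fin 2)),
    (∀ i, ContDiff ℝ 1 (γ i)) ∧ frontier Ω = ⋃ i, γ i '' Set.Icc (0 : ℝ) 1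
/-! ### One-variable analysis -/

lemma lintegral_deriv_eq {a b : ℝ} {g g' : ℝ → ℝ} (hab : a ≤ b)
    (hc : ContinuousOn g (Set.Icc a b)) (hd : ∀ x ∈ Set.Ioo a b, HasDerivAt g (g' x) x)
    (hn : ∀ x ∈ Set.Ioo a b, 0 ≤ g' x) :
    ∫⁻ x in Set.Ioo a b, ENNReal.ofReal (g' x) = ENNReal.ofReal (g b - g a) := by
  have hi := intervalIntegral.integrableOn_deriv_of_nonneg hc hd hn
  have h1 := intervalIntegral.integral_eq_sub_of_hasDerivAt_of_le hab hc hd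
    ((intervalIntegrable_iff_integrableOn_Ioc_of_le hab).2 hi)
  rw [intervalIntegral.integral_of_le hab, integral_Ioc_eq_integral_Ioo] at h1
  rw [← h1, ofReal_integral_eq_lintegral_ofReal (hi.mono_set Set.Ioo_subset_Ioc_self)]
  exact (ae_restrict_iff' measurableSet_Ioo).2 (Filter.Eventually.of_forall hn)

lemma arcsin_integral {a b : ℝ} (ha : 0 < a) (hab : a < b) :
    ∫⁻ r in Set.Ioo a b, ENNReal.ofReal
      ((r + a * b / r) / √((a + b) ^ 2 - (r + a * b / r) ^ 2) / r) = ENNReal.ofReal π := by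
  have hba : 0 < b - a := by linarith
  have hb : 0 < b := by linarith
  have key := lintegral_deriv_eq (a := a) (b := b)
    (g := fun r => arcsin ((r - a * b / r) / (b - a)))
    (g' := fun r => (r + a * b / r) / √((a + b) ^ 2 - (r + a * b / r) ^ 2) / r) hab.le ?_ ?_ ?_
  · rw [key]
    congr 1
    have e1 : (b - a * b / b) / (b - a) = 1 := by field_simp
    have e2 : (a - a * b / a) / (b - a) = -1 := by field_simp; ring
    simp only [e1, e2, arcsin_one, arcsin_neg]
    ring
  · apply continuous_arcsin.comp_continuousOn
    apply ContinuousOn.div_const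
    apply continuousOn_id.sub
    apply continuousOn_const.div continuousOn_id
    intro x hx; simp only [id]; linarith [hx.1]
  · intro r hr
    have hr0 : 0 < r := by linarith [hr.1]
    have hz1 : (r - a * b / r) / (b - a) < 1 := by
      rw [div_lt_one hba]
      have : (r - a * b / r) - (b - a) = -((b - r) * (r + a)) / r := by field_simp; ring
      have h2 : -((b - r) * (r + a)) / r < 0 := by
        apply div_neg_of_neg_of_pos _ hr0
        nlinarith [hr.1, hr.2]
      linarith
    have hz2 : -1 < (r - a * b / r) / (b - a) := by
      rw [lt_div_iff₀ hba]
      have : (r - a * b / r) + (b - a) = ((r - a) * (r + b)) / r := by field_simp; ring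
      have h2 : 0 < ((r - a) * (r + b)) / r := by
        apply div_pos _ hr0
        nlinarith [hr.1, hr.2]
      linarith
    have h1 : HasDerivAt (fun r : ℝ => (r - a * b / r) / (b - a))
        ((1 + a * b / r ^ 2) / (b - a)) r := by
      have := ((hasDerivAt_id' r).sub ((hasDerivAt_inv hr0.ne').const_mul (a * b))).div_const (b - a)
      simp only [div_eq_mul_inv (a * b)]
      refine this.congr_deriv ?_
      field_simp
      ring
    have h2 := (hasDerivAt_arcsin hz2.ne' hz1.ne).comp r h1
    refine h2.congr_deriv ?_
    have h3 : (a + b) ^ 2 - (r + a * b / r) ^ 2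
        = (b - a) ^ 2 * (1 - ((r - a * b / r) / (b - a)) ^ 2) := by
      field_simp; ring
    rw [h3, Real.sqrt_mul (by positivity), Real.sqrt_sq hba.le]
    have h4 : 0 < √(1 - ((r - a * b / r) / (b - a)) ^ 2) := by
      apply Real.sqrt_pos.2; nlinarith
    field_simp
  · intro r hr
    have hr0 : 0 < r := by linarith [hr.1]
    positivity

lemma pair_ineq {l l' Y Y' T s K e : ℝ} (hl : 0 < l) (hl' : 0 < l') (h1 : l < Y) (h2 : l' < Y')
    (hT : 0 ≤ T) (hTs : T < s) (hK : 0 < K) (he : 0 ≤ e) (hll : l * l' = K * T ^ 2 + e)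
    (hYY : Y * Y' = K * s ^ 2 + e) :
    2 * (T / √(s ^ 2 - T ^ 2)) ≤ l / √(Y ^ 2 - l ^ 2) + l' / √(Y' ^ 2 - l' ^ 2) := by
  have hA : 0 < Y ^ 2 - l ^ 2 := by nlinarith
  have hB : 0 < Y' ^ 2 - l' ^ 2 := by nlinarith
  have hC : 0 < s ^ 2 - T ^ 2 := by nlinarith
  have hD : 0 < Y * Y' - l * l' := by
    rw [hll, hYY]; nlinarith
  have hsq : √(Y ^ 2 - l ^ 2) * √(Y' ^ 2 - l' ^ 2) ≤ Y * Y' - l * l' := by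
    rw [← Real.sqrt_mul hA.le]
    apply Real.sqrt_le_iff.2 ⟨hD.le, ?_⟩
    nlinarith [sq_nonneg (Y * l' - l * Y')]
  set A := √(Y ^ 2 - l ^ 2) with hAd
  set B := √(Y' ^ 2 - l' ^ 2) with hBd
  have hA' : 0 < A := Real.sqrt_pos.2 hA
  have hB' : 0 < B := Real.sqrt_pos.2 hB
  have hw : (T / √(s ^ 2 - T ^ 2)) ^ 2 ≤ l / A * (l' / B) := by
    rw [div_pow, Real.sq_sqrt hC.le, div_mul_div_comm]
    calc T ^ 2 / (s ^ 2 - T ^ 2) ≤ (l * l') / (Y * Y' - l * l') := by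
          rw [div_le_div_iff₀ hC hD, hll, hYY]
          nlinarith [mul_nonneg he (sq_nonneg T), mul_nonneg he hC.le]
      _ ≤ (l * l') / (A * B) := by
          apply div_le_div_of_nonneg_left (by positivity) (by positivity) hsq
  have h0 : 0 ≤ T / √(s ^ 2 - T ^ 2) := by positivity
  have h3 : 0 < l / A := by positivity
  have h4 : 0 < l' / B := by positivity
  refine le_of_sq_le_sq ?_ (by positivity)
  nlinarith [sq_nonneg (l / A - l' / B)]

lemma J_bound {a b c d : ℝ} {Y : ℝ → ℝ} (ha : 0 < a) (hab : a < b) (hc : 0 < c) (hd : 0 < d)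
    (hYm : Measurable Y)
    (hYY : ∀ r ∈ Set.Ioo a b, Y r * Y (a * b / r) = Y a * Y b)
    (hYa : c * a ^ 2 + d = Y a) (hYb : c * b ^ 2 + d = Y b)
    (hlt : ∀ r ∈ Set.Ioo a b, c * r ^ 2 + d < Y r) :
    ENNReal.ofReal π ≤ ∫⁻ r in Set.Ioo a b,
      ENNReal.ofReal ((c * r ^ 2 + d) / √(Y r ^ 2 - (c * r ^ 2 + d) ^ 2) / r) := by
  have hb : 0 < b := by linarith
  set f : ℝ → ℝ := fun r => (c * r ^ 2 + d) / √(Y r ^ 2 - (c * r ^ 2 + d) ^ 2) with hf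
  have hfm : Measurable f := by
    rw [hf]; fun_prop
  have hmem : ∀ r ∈ Set.Ioo a b, a * b / r ∈ Set.Ioo a b := by
    intro r hr
    have hr0 : 0 < r := by linarith [hr.1]
    constructor
    · rw [lt_div_iff₀ hr0]; nlinarith [hr.2]
    · rw [div_lt_iff₀ hr0]; nlinarith [hr.1]
  have hinv : ∀ r ∈ Set.Ioo a b, a * b / (a * b / r) = r := by
    intro r hr
    have hr0 : 0 < r := by linarith [hr.1]
    field_simp
  have himg : (fun r => a * b / r) '' Set.Ioo a b = Set.Ioo a b := by
    ext x; constructor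
    · rintro ⟨r, hr, rfl⟩; exact hmem r hr
    · intro hx; exact ⟨a * b / x, hmem x hx, hinv x hx⟩
  have hinj : Set.InjOn (fun r => a * b / r) (Set.Ioo a b) := by
    intro x hx y hy hxy
    have := congrArg (fun z => a * b / z) hxy
    simpa only [hinv x hx, hinv y hy] using this
  have hrefl : ∫⁻ r in Set.Ioo a b, ENNReal.ofReal (f r / r)
      = ∫⁻ r in Set.Ioo a b, ENNReal.ofReal (f (a * b / r) / r) := by
    have := lintegral_image_eq_lintegral_abs_deriv_mul (s := Set.Ioo a b)
      (f := fun r => a * b / r) (f' := fun r => -(a * b / r ^ 2)) measurableSet_Ioo ?_ hinj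
      (fun r => ENNReal.ofReal (f r / r))
    · rw [himg] at this
      rw [this]
      apply setLIntegral_congr_fun measurableSet_Ioo
      intro r hr
      have hr0 : 0 < r := by linarith [hr.1]
      simp only
      rw [← ENNReal.ofReal_mul (abs_nonneg _)]
      congr 1
      rw [abs_neg, abs_of_pos (by positivity)]
      field_simp
    · intro r hr
      have hr0 : 0 < r := by linarith [hr.1]
      have := ((hasDerivAt_inv hr0.ne').const_mul (a * b)).hasDerivWithinAt (s := Set.Ioo a b)
      simp only [div_eq_mul_inv (a * b)]
      refine this.congr_deriv ?_
      field_simp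
  have hsum : 2 * ENNReal.ofReal π ≤ 2 * ∫⁻ r in Set.Ioo a b, ENNReal.ofReal (f r / r) := by
    rw [two_mul (∫⁻ r in Set.Ioo a b, ENNReal.ofReal (f r / r))]
    nth_rewrite 2 [hrefl]
    rw [← lintegral_add_left (by fun_prop), ← arcsin_integral ha hab,
      ← lintegral_const_mul' _ _ (by simp)]
    apply setLIntegral_mono' measurableSet_Ioo
    intro r hr
    have hr0 : 0 < r := by linarith [hr.1]
    have hr' := hmem r hr
    have hr'0 : 0 < a * b / r := by positivity
    have hf0 : ∀ r, 0 ≤ f r := fun r => by simp only [hf]; positivity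
    rw [← ENNReal.ofReal_add (div_nonneg (hf0 _) hr0.le) (div_nonneg (hf0 _) hr0.le)]
    rw [show (2 : ENNReal) = ENNReal.ofReal 2 by simp, ← ENNReal.ofReal_mul (by norm_num)]
    apply ENNReal.ofReal_le_ofReal
    rw [← add_div, ← mul_div_assoc]
    apply div_le_div_of_nonneg_right _ hr0.le
    apply pair_ineq (K := c * d) (e := (c * (a * b) - d) ^ 2) (by positivity) (by positivity)
      (hlt r hr) (hlt _ hr') (by positivity) _ (by positivity) (by positivity)
    · field_simp; ring
    · rw [hYY r hr, ← hYa, ← hYb]; ring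
    · have : a + b - (r + a * b / r) = (r - a) * (b - r) / r := by field_simp; ring
      have h2 : 0 < (r - a) * (b - r) / r :=
        div_pos (mul_pos (by linarith [hr.1]) (by linarith [hr.2])) hr0
      linarith
  exact (ENNReal.mul_le_mul_iff_right (by norm_num) (by norm_num)).1 hsum

lemma chord_lt {q x0 x1 x c d : ℝ} (hq0 : 0 < q) (hq1 : q < 1) (h0 : 0 ≤ x0) (h1 : x0 < x)
    (h2 : x < x1) (e0 : c * x0 + d = x0 ^ q) (e1 : c * x1 + d = x1 ^ q) : c * x + d < x ^ q := by
  have hpos : 0 < x1 - x0 := by linarith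
  have hne : x0 ≠ x1 := by rintro rfl; linarith
  have ha : 0 < (x1 - x) / (x1 - x0) := div_pos (by linarith) hpos
  have hb : 0 < (x - x0) / (x1 - x0) := div_pos (by linarith) hpos
  have h0' : x0 ∈ Set.Ici (0 : ℝ) := h0
  have h1' : x1 ∈ Set.Ici (0 : ℝ) := show (0 : ℝ) ≤ x1 by linarith
  have h := (Real.strictConcaveOn_rpow hq0 hq1).2 h0' h1' hne ha hb (by field_simp; ring)
  simp only [smul_eq_mul] at h
  have e : (x1 - x) / (x1 - x0) * x0 + (x - x0) / (x1 - x0) * x1 = x := by field_simp; ring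
  rw [e, ← e0, ← e1] at h
  calc c * x + d = (x1 - x) / (x1 - x0) * (c * x0 + d) + (x - x0) / (x1 - x0) * (c * x1 + d) := by
        field_simp; ring
    _ < _ := h

lemma layer_bound {Y l m r : ℝ} (hl : 0 ≤ l) (hlY : l ≤ Y) (hr : 0 < r) :
    ∫⁻ s in Set.Ioo 0 m, ENNReal.ofReal ((l + s) / √(Y ^ 2 - (l + s) ^ 2) / r)
      ≤ ENNReal.ofReal (√(Y ^ 2 - l ^ 2) / r) := by
  have h1 : ∫⁻ s in Set.Ioo 0 m, ENNReal.ofReal ((l + s) / √(Y ^ 2 - (l + s) ^ 2) / r)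
      ≤ ∫⁻ s in Set.Ioo 0 (Y - l), ENNReal.ofReal ((l + s) / √(Y ^ 2 - (l + s) ^ 2) / r) := by
    rw [← lintegral_indicator measurableSet_Ioo, ← lintegral_indicator measurableSet_Ioo]
    apply lintegral_mono
    intro s
    by_cases hs : s ∈ Set.Ioo 0 m
    · by_cases hs' : s ∈ Set.Ioo 0 (Y - l)
      · simp [hs, hs']
      · have hsY : Y - l ≤ s := by
          by_contra hcon
          exact hs' ⟨hs.1, not_le.1 hcon⟩
        have : √(Y ^ 2 - (l + s) ^ 2) = 0 := by
          apply Real.sqrt_eq_zero_of_nonpos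
          nlinarith
        simp [hs, hs', this]
    · simp [hs]
  refine h1.trans ?_
  have key := lintegral_deriv_eq (a := 0) (b := Y - l)
    (g := fun s => -√(Y ^ 2 - (l + s) ^ 2) / r)
    (g' := fun s => (l + s) / √(Y ^ 2 - (l + s) ^ 2) / r) (by linarith) (by fun_prop) ?_ ?_
  · rw [key]
    apply le_of_eq
    congr 1
    simp
    ring
  · intro s hs
    have hpos : 0 < Y ^ 2 - (l + s) ^ 2 := by nlinarith [hs.1, hs.2]
    have h2 : HasDerivAt (fun s : ℝ => Y ^ 2 - (l + s) ^ 2) (-(2 * (l + s))) s := by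
      have := (((hasDerivAt_id' s).const_add l).pow 2).const_sub (Y ^ 2)
      refine this.congr_deriv ?_
      simp
    have h3 := (h2.sqrt hpos.ne').neg.div_const r
    refine h3.congr_deriv ?_
    have := Real.sqrt_pos.2 hpos
    field_simp
  · intro s hs
    have : 0 ≤ l + s := by linarith [hs.1]
    positivity

lemma I_bound {a0 b0 c d q X : ℝ} (ha0 : 0 < a0) (hab : a0 < b0) (hq0 : 0 < q) (hq1 : q < 1)
    (hc : 0 < c) (hd : 0 ≤ d) (hYa : c * a0 ^ 2 + d = (a0 ^ 2) ^ q)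
    (hYb : c * b0 ^ 2 + d = (b0 ^ 2) ^ q) (hX0 : a0 ^ 2 ≤ X) (hX1 : X ≤ b0 ^ 2) :
    ENNReal.ofReal (π * (X ^ q - (c * X + d))) ≤ ∫⁻ r in Set.Ioo a0 b0,
      ENNReal.ofReal (√(((r ^ 2) ^ q) ^ 2 - (c * r ^ 2 + d) ^ 2) / r) := by
  set M := X ^ q - (c * X + d) with hM
  rcases le_or_gt M 0 with hM0 | hM0
  · rw [ENNReal.ofReal_of_nonpos (by nlinarith [Real.pi_pos])]; exact zero_le
  set ξ := √X with hξ
  have hX : 0 < X := lt_of_lt_of_le (by positivity) hX0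
  have hξX : ξ ^ 2 = X := Real.sq_sqrt hX.le
  have hξ0 : 0 < ξ := Real.sqrt_pos.2 hX
  have ha0ξ : a0 ≤ ξ := by apply le_of_sq_le_sq _ hξ0.le; rw [hξX]; exact hX0
  have hξb0 : ξ ≤ b0 := by apply le_of_sq_le_sq _ (by linarith); rw [hξX]; exact hX1
  set φ : ℝ → ℝ := fun r => (r ^ 2) ^ q - (c * r ^ 2 + d) with hφ
  have hφc : Continuous φ := by
    have : Continuous fun r : ℝ => (r ^ 2) ^ q := (continuous_pow 2).rpow_const (by simp [hq0.le])
    rw [hφ]; fun_prop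
  have hφa : φ a0 = 0 := by simp only [hφ]; linarith
  have hφb : φ b0 = 0 := by simp only [hφ]; linarith
  have hφξ : φ ξ = M := by simp only [hφ, hξX, hM]
  have hYm : Measurable fun r : ℝ => (r ^ 2) ^ q := by fun_prop
  have hJ : ∀ s ∈ Set.Ioo 0 M, ENNReal.ofReal π ≤ ∫⁻ r in Set.Ioo a0 b0,
      ENNReal.ofReal (((c * r ^ 2 + d) + s) /
        √(((r ^ 2) ^ q) ^ 2 - ((c * r ^ 2 + d) + s) ^ 2) / r) := by
    intro s hs
    obtain ⟨a, ha, has⟩ := intermediate_value_Ioo ha0ξ hφc.continuousOn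
      (show s ∈ Set.Ioo (φ a0) (φ ξ) by rwa [hφa, hφξ])
    obtain ⟨b, hb, hbs⟩ := intermediate_value_Ioo' hξb0 hφc.continuousOn
      (show s ∈ Set.Ioo (φ b0) (φ ξ) by rwa [hφb, hφξ])
    have hapos : 0 < a := by linarith [ha.1]
    have hbpos : 0 < b := by linarith [hb.1]
    have hab' : a < b := by linarith [ha.2, hb.1]
    have hea : c * a ^ 2 + (d + s) = (a ^ 2) ^ q := by simp only [hφ] at has; linarith
    have heb : c * b ^ 2 + (d + s) = (b ^ 2) ^ q := by simp only [hφ] at hbs; linarith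
    have := J_bound (Y := fun r => (r ^ 2) ^ q) hapos hab' hc (d := d + s) (by linarith [hs.1])
      hYm ?_ hea heb ?_
    · refine this.trans ?_
      simp only [← add_assoc]
      apply lintegral_mono_set
      exact Set.Ioo_subset_Ioo ha.1.le hb.2.le
    · intro r hr
      have hr0 : 0 < r := by linarith [hr.1]
      rw [← Real.mul_rpow (by positivity) (by positivity),
        ← Real.mul_rpow (by positivity) (by positivity)]
      congr 1
      field_simp
    · intro r hr
      exact chord_lt hq0 hq1 (sq_nonneg a) (by nlinarith [hr.1]) (by nlinarith [hr.2, hr.1]) hea heb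
  calc ENNReal.ofReal (π * M) = ∫⁻ s in Set.Ioo 0 M, ENNReal.ofReal π := by
        rw [setLIntegral_const, Real.volume_Ioo, sub_zero, ENNReal.ofReal_mul Real.pi_pos.le]
    _ ≤ ∫⁻ s in Set.Ioo 0 M, ∫⁻ r in Set.Ioo a0 b0,
      ENNReal.ofReal (((c * r ^ 2 + d) + s) /
        √(((r ^ 2) ^ q) ^ 2 - ((c * r ^ 2 + d) + s) ^ 2) / r) :=
        setLIntegral_mono' measurableSet_Ioo hJ
    _ = ∫⁻ r in Set.Ioo a0 b0, ∫⁻ s in Set.Ioo 0 M,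
      ENNReal.ofReal (((c * r ^ 2 + d) + s) /
        √(((r ^ 2) ^ q) ^ 2 - ((c * r ^ 2 + d) + s) ^ 2) / r) := by
        apply lintegral_lintegral_swap
        apply Measurable.aemeasurable
        unfold Function.uncurry
        fun_prop
    _ ≤ _ := by
        apply setLIntegral_mono' measurableSet_Ioo
        intro r hr
        have hr0 : 0 < r := by linarith [hr.1]
        apply layer_bound (by positivity) _ hr0
        exact (chord_lt hq0 hq1 (sq_nonneg a0) (by nlinarith [hr.1])
          (by nlinarith [hr.2, hr.1]) hYa hYb).le

lemma setLIntegral_image_le {f f' : ℝ → ℝ} {A : Set ℝ} (hA : MeasurableSet A) (hf : Measurable f)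
    (hf' : Measurable f') (hd : ∀ t ∈ A, HasDerivWithinAt f (f' t) A t) {H : ℝ → ENNReal}
    (hH : Measurable H) :
    ∫⁻ x in f '' A, H x ≤ ∫⁻ t in A, ENNReal.ofReal |f' t| * H (f t) := by
  have hm : Measurable fun t => ENNReal.ofReal |f' t| := by fun_prop
  have key : volume.restrict (f '' A) ≤
      Measure.map f ((volume.restrict A).withDensity fun t => ENNReal.ofReal |f' t|) := by
    rw [Measure.le_iff]
    intro U hU
    rw [Measure.restrict_apply hU, Measure.map_apply hf hU, withDensity_apply _ (hf hU),
      Measure.restrict_restrict (hf hU), Set.inter_comm U, ← Set.image_inter_preimage,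
      Set.inter_comm A]
    refine (addHaar_image_le_lintegral_abs_det_fderiv volume ((hf hU).inter hA)
      (f' := fun t => ContinuousLinearMap.toSpanSingleton ℝ (f' t)) ?_).trans ?_
    · intro t ht
      exact ((hd t ht.2).mono Set.inter_subset_right).hasFDerivWithinAt
    · simp only [ContinuousLinearMap.det_toSpanSingleton, le_refl]
  refine (lintegral_mono' key le_rfl).trans ?_
  rw [lintegral_map hH hf, lintegral_withDensity_eq_lintegral_mul _ hm
    (show Measurable fun t => H (f t) from hH.comp hf)]
  rfl

lemma setLIntegral_cover_le {ι : Type*} [Fintype ι] {f f' : ι → ℝ → ℝ} {A : ι → Set ℝ}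
    (hA : ∀ i, MeasurableSet (A i)) (hf : ∀ i, Measurable (f i))
    (hf' : ∀ i, Measurable (f' i)) (hd : ∀ i, ∀ t ∈ A i, HasDerivWithinAt (f i) (f' i t) (A i) t)
    {H : ℝ → ENNReal} (hH : Measurable H) {T : Set ℝ} (hT : T ⊆ ⋃ i, f i '' A i) :
    ∫⁻ x in T, H x ≤ ∑ i, ∫⁻ t in A i, ENNReal.ofReal |f' i t| * H (f i t) := by
  refine (lintegral_mono_set hT).trans ((lintegral_iUnion_le _ _).trans ?_)
  rw [tsum_fintype]
  exact Finset.sum_le_sum fun i _ => setLIntegral_image_le (hA i) (hf i) (hf' i) (hd i) hH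

lemma lintegral_speed_le_aux {γ : ℝ → ℂ} (hγ : ContDiff ℝ 1 γ) {P : Set ℝ} (hP : MeasurableSet P)
    {e : ℂ} (he : ‖e‖ ≤ 1) {c : ENNReal} {J : Set ℝ} (hJ : Convex ℝ J) (hPJ : P ⊆ J)
    (hpos : ∀ s ∈ J, 0 < inner ℝ e (deriv γ s))
    (hc : ∀ s ∈ J, c * ENNReal.ofReal ‖deriv γ s‖ ≤ ENNReal.ofReal (inner ℝ e (deriv γ s))) :
    c * ∫⁻ t in P, ENNReal.ofReal ‖deriv γ t‖ ≤ μH[1] (γ '' P) := by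
  have hdγ : ∀ t, HasDerivAt γ (deriv γ t) t := fun t =>
    ((hγ.differentiable one_ne_zero) t).hasDerivAt
  have hcd : Continuous (deriv γ) := hγ.continuous_deriv le_rfl
  set g : ℝ → ℝ := fun t => innerSL ℝ e (γ t) with hg
  have hdg : ∀ t, HasDerivAt g (inner ℝ e (deriv γ t)) t := fun t =>
    (innerSL ℝ e).hasFDerivAt.comp_hasDerivAt t (hdγ t)
  have hgmono : StrictMonoOn g J := by
    apply strictMonoOn_of_deriv_pos hJ (fun t _ => (hdg t).continuousAt.continuousWithinAt)
    intro t ht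
    rw [(hdg t).deriv]
    exact hpos t (interior_subset ht)
  have h1 := lintegral_image_eq_lintegral_abs_deriv_mul hP
    (fun t _ => (hdg t).hasDerivWithinAt) (hgmono.injOn.mono hPJ) (fun _ => 1)
  simp only [lintegral_const, one_mul, mul_one, Measure.restrict_apply MeasurableSet.univ,
    Set.univ_inter] at h1
  have hgi : g '' P = (innerSL ℝ e) '' (γ '' P) := by rw [Set.image_image]
  have h2 : volume (g '' P) ≤ μH[1] (γ '' P) := by
    rw [hgi, ← hausdorffMeasure_real]
    have hl : LipschitzWith 1 (innerSL ℝ e : ℂ →L[ℝ] ℝ) := by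
      apply (innerSL ℝ e).lipschitz.weaken
      rw [← NNReal.coe_le_coe]
      simpa using he
    simpa using hl.hausdorffMeasure_image_le zero_le_one (γ '' P)
  refine le_trans ?_ h2
  rw [h1, ← lintegral_const_mul _ (by fun_prop)]
  apply setLIntegral_mono' hP
  intro t ht
  rw [abs_of_pos (hpos t (hPJ ht))]
  exact hc t (hPJ ht)

lemma lintegral_speed_le {γ : ℝ → ℂ} (hγ : ContDiff ℝ 1 γ) {E : Set ℝ} (hE : MeasurableSet E)
    (hinj : Set.InjOn γ E) :
    ∫⁻ t in E, ENNReal.ofReal ‖deriv γ t‖ ≤ μH[1] (γ '' E) := by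
  have hcd : Continuous (deriv γ) := hγ.continuous_deriv le_rfl
  rw [← one_mul (∫⁻ t in E, _)]
  apply ENNReal.mul_le_of_forall_lt
  intro c hc x hx
  refine (mul_le_mul_right hx.le c).trans ?_
  clear hx x
  lift c to NNReal using (hc.trans ENNReal.one_lt_top).ne
  have hc' : (c : ℝ) < 1 := by exact_mod_cast hc
  set Z : Set ℝ := {t | deriv γ t ≠ 0} with hZ
  have hZo : IsOpen Z := isOpen_ne_fun hcd continuous_const
  set e : ℝ → ℂ := fun t => (‖deriv γ t‖⁻¹ : ℝ) • deriv γ t with he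
  have hball : ∀ t, ∃ δ, t ∈ Z → 0 < δ ∧ ∀ s ∈ Metric.ball t δ,
      (c : ℝ) * ‖deriv γ s‖ < inner ℝ (e t) (deriv γ s) := by
    intro t
    by_cases ht : t ∈ Z
    · have ht' : 0 < ‖deriv γ t‖ := norm_pos_iff.2 ht
      have hop : IsOpen {s | (c : ℝ) * ‖deriv γ s‖ < inner ℝ (e t) (deriv γ s)} :=
        isOpen_lt (by fun_prop) (by fun_prop)
      have hmem : t ∈ {s | (c : ℝ) * ‖deriv γ s‖ < inner ℝ (e t) (deriv γ s)} := by
        simp only [Set.mem_ofPred_eq, he, real_inner_smul_left, real_inner_self_eq_norm_sq]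
        have : ‖deriv γ t‖⁻¹ * ‖deriv γ t‖ ^ 2 = ‖deriv γ t‖ := by field_simp
        rw [this]
        nlinarith
      obtain ⟨δ, hδ, hsub⟩ := Metric.isOpen_iff.1 hop t hmem
      exact ⟨δ, fun _ => ⟨hδ, fun s hs => hsub hs⟩⟩
    · exact ⟨0, fun h => absurd h ht⟩
  choose δ hδ using hball
  obtain ⟨T, hTZ, hTc, hcov⟩ := TopologicalSpace.countable_cover_nhdsWithin
    (f := fun t => Metric.ball t (δ t)) (s := Z) (fun t ht =>
      mem_nhdsWithin_of_mem_nhds (Metric.ball_mem_nhds _ (hδ t ht).1))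
  have hIntegr : ∫⁻ t in E, ENNReal.ofReal ‖deriv γ t‖ = ∫⁻ t in E ∩ Z, ENNReal.ofReal ‖deriv γ t‖ := by
    rw [← lintegral_indicator hE, ← lintegral_indicator (hE.inter hZo.measurableSet)]
    congr 1
    ext t
    by_cases h1 : t ∈ E <;> by_cases h2 : deriv γ t = 0 <;> simp [hZ, h1, h2, Set.indicator]
  rw [hIntegr]
  rcases T.eq_empty_or_nonempty with hTe | hTn
  · have : Z = ∅ := by simpa [hTe] using hcov
    simp [this]
  obtain ⟨τ, hτ⟩ := hTc.exists_eq_range hTn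
  have hτZ : ∀ n, τ n ∈ Z := fun n => hTZ (hτ ▸ Set.mem_range_self n)
  set D := disjointed (fun n => Metric.ball (τ n) (δ (τ n))) with hD
  have hDm : ∀ n, MeasurableSet (D n) := MeasurableSet.disjointed fun n => measurableSet_ball
  have hDcov : E ∩ Z ⊆ ⋃ n, E ∩ D n := by
    rw [← Set.inter_iUnion, hD, iUnion_disjointed]
    apply Set.inter_subset_inter_right
    rw [hτ] at hcov
    simpa using hcov
  have hdisj : Pairwise (Function.onFun Disjoint fun n => E ∩ D n) := fun i j hij =>
    (disjoint_disjointed _ hij).mono Set.inter_subset_right Set.inter_subset_right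
  have himg : γ '' E ⊇ ⋃ n, γ '' (E ∩ D n) :=
    Set.iUnion_subset fun n => Set.image_mono Set.inter_subset_left
  calc (c : ENNReal) * ∫⁻ t in E ∩ Z, ENNReal.ofReal ‖deriv γ t‖
      ≤ c * ∑' n, ∫⁻ t in E ∩ D n, ENNReal.ofReal ‖deriv γ t‖ := by
        gcongr
        exact (lintegral_mono_set hDcov).trans (lintegral_iUnion_le _ _)
    _ = ∑' n, c * ∫⁻ t in E ∩ D n, ENNReal.ofReal ‖deriv γ t‖ := ENNReal.tsum_mul_left.symm
    _ ≤ ∑' n, μH[1] (γ '' (E ∩ D n)) := by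
        apply ENNReal.tsum_le_tsum
        intro n
        have hb := (hδ _ (hτZ n)).2
        apply lintegral_speed_le_aux hγ (hE.inter (hDm n)) (e := e (τ n)) _
          (convex_ball (τ n) (δ (τ n)))
        · exact Set.inter_subset_right.trans (disjointed_subset _ n)
        · intro s hs
          exact lt_of_le_of_lt (by positivity) (hb s hs)
        · intro s hs
          have := (hb s hs).le
          rw [← ENNReal.ofReal_coe_nnreal, ← ENNReal.ofReal_mul (by positivity)]
          exact ENNReal.ofReal_le_ofReal this
        · have : 0 < ‖deriv γ (τ n)‖ := norm_pos_iff.2 (hτZ n)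
          rw [he]
          simp only [norm_smul, norm_inv, norm_norm]
          rw [inv_mul_cancel₀ this.ne']
    _ = μH[1] (⋃ n, γ '' (E ∩ D n)) := by
        rw [measure_iUnion]
        · intro i j hij
          apply Set.disjoint_image_image
          rintro x hx y hy hxy
          have := hinj hx.1 hy.1 hxy
          subst this
          exact Set.disjoint_left.1 (hdisj hij) hx hy
        · intro n
          exact (hE.inter (hDm n)).image_of_continuousOn_injOn hγ.continuous.continuousOn
            (hinj.mono Set.inter_subset_left)
    _ ≤ μH[1] (γ '' E) := measure_mono himg

lemma lintegral_speed_mul_le {γ : ℝ → ℂ} (hγ : ContDiff ℝ 1 γ) {E : Set ℝ} (hE : MeasurableSet E)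
    (hinj : Set.InjOn γ E) {h : ℂ → ENNReal} (hh : Measurable h) :
    ∫⁻ t in E, ENNReal.ofReal ‖deriv γ t‖ * h (γ t) ≤ ∫⁻ z in γ '' E, h z ∂μH[1] := by
  have hcd : Continuous (deriv γ) := hγ.continuous_deriv le_rfl
  have hm : Measurable fun t => ENNReal.ofReal ‖deriv γ t‖ := by fun_prop
  have hf : Measurable γ := hγ.continuous.measurable
  have key : Measure.map γ ((volume.restrict E).withDensity fun t => ENNReal.ofReal ‖deriv γ t‖) ≤
      (μH[1] : Measure ℂ).restrict (γ '' E) := by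
    rw [Measure.le_iff]
    intro U hU
    rw [Measure.restrict_apply hU, Measure.map_apply hf hU, withDensity_apply _ (hf hU),
      Measure.restrict_restrict (hf hU), Set.inter_comm U, ← Set.image_inter_preimage,
      Set.inter_comm E]
    exact lintegral_speed_le hγ ((hf hU).inter hE) (hinj.mono Set.inter_subset_right)
  refine le_trans ?_ (lintegral_mono' key le_rfl)
  rw [lintegral_map hh hf, lintegral_withDensity_eq_lintegral_mul _ hm
    (show Measurable fun t => h (γ t) from hh.comp hf)]
  rfl

/-- Parameters `t` of the `i`-th curve at which the point `φ i t` is visited for the first time. -/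
def firstTimes {n : ℕ} {X : Type*} (φ : Fin n → ℝ → X) (i : Fin n) : Set ℝ :=
  {t | t ∈ Set.Icc (0 : ℝ) 1 ∧ (∀ j < i, ∀ s ∈ Set.Icc (0 : ℝ) 1, φ j s ≠ φ i t) ∧
    ∀ s ∈ Set.Icc (0 : ℝ) 1, s < t → φ i s ≠ φ i t}

lemma firstTimes_unique {n : ℕ} {X : Type*} {φ : Fin n → ℝ → X} {i j : Fin n} {s t : ℝ}
    (ht : t ∈ firstTimes φ i) (hs : s ∈ firstTimes φ j) (h : φ i t = φ j s) : i = j ∧ t = s := by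
  have hij : i = j := by
    rcases lt_trichotomy i j with h1 | h1 | h1
    · exact absurd h (hs.2.1 i h1 t ht.1)
    · exact h1
    · exact absurd h.symm (ht.2.1 j h1 s hs.1)
  subst hij
  refine ⟨rfl, ?_⟩
  rcases lt_trichotomy t s with h1 | h1 | h1
  · exact absurd h (hs.2.2 t ht.1 h1)
  · exact h1
  · exact absurd h.symm (ht.2.2 s hs.1 h1)

lemma firstTimes_exists {n : ℕ} {X : Type*} [TopologicalSpace X] [T2Space X] {φ : Fin n → ℝ → X}
    (hφ : ∀ i, Continuous (φ i)) {i : Fin n} {s : ℝ} (hs : s ∈ Set.Icc (0 : ℝ) 1) :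
    ∃ j, ∃ t ∈ firstTimes φ j, φ j t = φ i s := by
  have hne : {j : Fin n | ∃ t ∈ Set.Icc (0 : ℝ) 1, φ j t = φ i s}.Nonempty := ⟨i, s, hs, rfl⟩
  obtain ⟨j, ⟨t0, ht0, ht0'⟩, hj⟩ := WellFounded.has_min wellFounded_lt _ hne
  have hK : IsCompact (Set.Icc (0 : ℝ) 1 ∩ φ j ⁻¹' {φ i s}) :=
    isCompact_Icc.inter_right (isClosed_singleton.preimage (hφ j))
  obtain ⟨t, ht, htl⟩ := hK.exists_isLeast ⟨t0, ht0, ht0'⟩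
  have ht2 : φ j t = φ i s := ht.2
  refine ⟨j, t, ⟨ht.1, ?_, ?_⟩, ht2⟩
  · intro k hk s' hs' heq
    exact hj k ⟨s', hs', heq.trans ht2⟩ hk
  · intro s' hs' hlt heq
    exact absurd (htl ⟨hs', heq.trans ht2⟩) (not_le.2 hlt)

lemma firstTimes_measurable {n : ℕ} {X : Type*} [TopologicalSpace X] [T2Space X]
    {φ : Fin n → ℝ → X} (hφ : ∀ i, Continuous (φ i)) (i : Fin n) :
    MeasurableSet (firstTimes φ i) := by
  set K : ℕ → Set ℝ := fun m => Prod.snd '' ((Set.Icc (0 : ℝ) 1 ×ˢ Set.Icc (0 : ℝ) 1) ∩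
    {x : ℝ × ℝ | x.1 ≤ x.2 - 1 / ((m : ℝ) + 1) ∧ φ i x.1 = φ i x.2}) with hK
  have hKc : ∀ m, IsCompact (K m) := by
    intro m
    apply IsCompact.image _ continuous_snd
    apply (isCompact_Icc.prod isCompact_Icc).inter_right
    have h1 : IsClosed {x : ℝ × ℝ | x.1 ≤ x.2 - 1 / ((m : ℝ) + 1)} :=
      isClosed_le (by fun_prop) (by fun_prop)
    refine h1.inter ?_
    · exact isClosed_eq ((hφ i).comp continuous_fst) ((hφ i).comp continuous_snd)
  have heq : firstTimes φ i = (Set.Icc (0 : ℝ) 1 ∩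
      ⋂ j, ⋂ (_ : j < i), (φ i ⁻¹' (φ j '' Set.Icc (0 : ℝ) 1))ᶜ) ∩ (⋃ m, K m)ᶜ := by
    ext t
    simp only [firstTimes, Set.mem_ofPred_eq, Set.mem_inter_iff, Set.mem_iInter,
      Set.mem_compl_iff, Set.mem_preimage, Set.mem_iUnion, not_exists, hK, Set.mem_image,
      and_assoc]
    refine and_congr_right fun ht => and_congr ?_ ?_
    · refine forall_congr' fun j => forall_congr' fun _ => ?_
      constructor
      · rintro h s ⟨hs, hs'⟩
        exact h s hs hs'
      · intro h s hs hs'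
        exact h s ⟨hs, hs'⟩
    · constructor
      · rintro h m ⟨s, t'⟩ ⟨⟨hs, _⟩, hle, hst, rfl⟩
        refine h s hs ?_ hst
        have : (0 : ℝ) < 1 / ((m : ℝ) + 1) := by positivity
        simp only at hle ⊢
        linarith
      · intro h s hs hlt hst
        obtain ⟨m, hm⟩ := exists_nat_one_div_lt (sub_pos.2 hlt)
        exact h m (s, t) ⟨⟨hs, ht⟩, by simp only; linarith, hst, rfl⟩
  rw [heq]
  refine (measurableSet_Icc.inter ?_).inter (MeasurableSet.iUnion fun m => (hKc m).measurableSet).compl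
  refine MeasurableSet.iInter fun j => MeasurableSet.iInter fun _ => ?_
  exact ((((isCompact_Icc.image (hφ j)).isClosed).preimage (hφ i)).measurableSet).compl

lemma hasDerivAt_norm_curve {γ : ℝ → ℂ} {v : ℂ} {t : ℝ} (h : HasDerivAt γ v t) (h0 : γ t ≠ 0) :
    HasDerivAt (fun s => ‖γ s‖) ((v / γ t).re * ‖γ t‖) t := by
  have hpos : 0 < ‖γ t‖ := norm_pos_iff.2 h0
  have h1 := (h.norm_sq).sqrt (by positivity)
  simp only [Real.sqrt_sq (norm_nonneg _)] at h1
  refine h1.congr_deriv ?_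
  rw [Complex.div_re, Complex.normSq_eq_norm_sq, Complex.inner]
  simp
  field_simp

lemma hasDerivAt_arg_curve {γ : ℝ → ℂ} {v : ℂ} {t : ℝ} (h : HasDerivAt γ v t)
    (h0 : γ t ∈ Complex.slitPlane) :
    HasDerivAt (fun s => (γ s).arg) ((v / γ t).im) t := by
  have h1 := h.clog_real h0
  have h2 := Complex.imCLM.hasFDerivAt.comp_hasDerivAt t h1
  simpa [Function.comp_def, Complex.log_im] using h2

lemma cs_point {a b G k ρ p : ℝ} (hρ : 0 < ρ) (_hG : 0 ≤ G) (_hk : 0 ≤ k)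
    (h : (G / ρ) ^ 2 + k ^ 2 ≤ (ρ ^ p) ^ 2) :
    |b| * G + |a * ρ| * k ≤ (ρ * √(a ^ 2 + b ^ 2)) * ρ ^ p := by
  have hs : 0 ≤ √(a ^ 2 + b ^ 2) := Real.sqrt_nonneg _
  have hp : 0 < ρ ^ p := Real.rpow_pos_of_pos hρ p
  have key : |b| * (G / ρ) + |a| * k ≤ √(a ^ 2 + b ^ 2) * ρ ^ p := by
    apply le_of_sq_le_sq _ (by positivity)
    rw [mul_pow, Real.sq_sqrt (by positivity), ← sq_abs a, ← sq_abs b]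
    set A := |a|
    set B := |b|
    set g := G / ρ
    have : (B * g + A * k) ^ 2 ≤ (A ^ 2 + B ^ 2) * (g ^ 2 + k ^ 2) := by
      nlinarith [sq_nonneg (A * g - B * k)]
    refine this.trans ?_
    gcongr
  have e : |b| * G + |a * ρ| * k = ρ * (|b| * (G / ρ) + |a| * k) := by
    rw [abs_mul, abs_of_pos hρ]
    field_simp
  rw [e, mul_assoc]
  gcongr

theorem geometric_bound {n : ℕ} {γ : Fin n → ℝ → ℂ} (hγ : ∀ i, ContDiff ℝ 1 (γ i)) {S : Set ℂ}
    (hS : S = ⋃ i, γ i '' Set.Icc (0 : ℝ) 1) (h0 : (0 : ℂ) ∉ S) {p r0 Rm : ℝ}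
    {R : ℝ → ℝ} (hR : Measurable R)
    (hRS : ∀ θ ∈ Set.Ioo (-π) π, ∃ z ∈ S, ‖z‖ = R θ ∧ z.arg = θ)
    (htwo : ∀ r ∈ Set.Ioo r0 Rm, ∃ z ∈ S, ∃ w ∈ S, z ≠ w ∧ ‖z‖ = r ∧ ‖w‖ = r)
    {G k : ℝ → ℝ} (hG : Measurable G) (hk : Measurable k) (hG0 : ∀ r, 0 ≤ G r)
    (hk0 : ∀ r, 0 ≤ k r) (hGk : ∀ r, 0 < r → (G r / r) ^ 2 + (k r) ^ 2 ≤ (r ^ p) ^ 2) :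
    (∫⁻ θ in Set.Ioo (-π) π, ENNReal.ofReal (G (R θ))) +
      2 * ∫⁻ r in Set.Ioo r0 Rm, ENNReal.ofReal (k r)
      ≤ ∫⁻ z in S, ENNReal.ofReal (‖z‖ ^ p) ∂μH[1] := by
  have hc : ∀ i, Continuous (γ i) := fun i => (hγ i).continuous
  have hd : ∀ i t, HasDerivAt (γ i) (deriv (γ i) t) t := fun i t =>
    (((hγ i).differentiable one_ne_zero) t).hasDerivAt
  have hcd : ∀ i, Continuous (deriv (γ i)) := fun i => (hγ i).continuous_deriv le_rfl
  have hmS : ∀ i, ∀ t ∈ Set.Icc (0 : ℝ) 1, γ i t ∈ S := fun i t ht => by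
    rw [hS]; exact Set.mem_iUnion.2 ⟨i, t, ht, rfl⟩
  have hne : ∀ i, ∀ t ∈ Set.Icc (0 : ℝ) 1, γ i t ≠ 0 := fun i t ht h => h0 (h ▸ hmS i t ht)
  set E := firstTimes γ with hE
  set F := firstTimes (fun i t => ‖γ i t‖) with hF
  have hEm : ∀ i, MeasurableSet (E i) := firstTimes_measurable hc
  have hFm : ∀ i, MeasurableSet (F i) := firstTimes_measurable fun i => (hc i).norm
  have hFE : ∀ i, F i ⊆ E i := fun i t ht =>
    ⟨ht.1, fun j hj s hs h => ht.2.1 j hj s hs (congrArg norm h),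
      fun s hs hlt h => ht.2.2 s hs hlt (congrArg norm h)⟩
  have hcov : ∀ z ∈ S, ∃ i, ∃ t ∈ E i, γ i t = z := by
    intro z hz
    rw [hS] at hz
    obtain ⟨i, s, hs, rfl⟩ := Set.mem_iUnion.1 hz
    exact firstTimes_exists hc hs
  set h : ℂ → ENNReal := fun z => ENNReal.ofReal (‖z‖ ^ p) with hh
  have hhm : Measurable h := by
    rw [hh]; fun_prop
  -- the length integral
  have hlen : ∑ i, ∫⁻ t in E i, ENNReal.ofReal ‖deriv (γ i) t‖ * h (γ i t) ≤
      ∫⁻ z in S, h z ∂μH[1] := by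
    have hinj : ∀ i, Set.InjOn (γ i) (E i) := fun i s hs t ht hst => (firstTimes_unique hs ht hst).2
    calc _ ≤ ∑ i, ∫⁻ z in γ i '' E i, h z ∂μH[1] :=
          Finset.sum_le_sum fun i _ => lintegral_speed_mul_le (hγ i) (hEm i) (hinj i) hhm
      _ = ∫⁻ z in ⋃ i, γ i '' E i, h z ∂μH[1] := by
          rw [lintegral_iUnion, tsum_fintype]
          · exact fun i => (hEm i).image_of_continuousOn_injOn (hc i).continuousOn (hinj i)
          · intro i j hij
            apply Set.disjoint_image_image
            intro s hs t ht hst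
            exact hij (firstTimes_unique hs ht hst).1
      _ ≤ _ := by
          apply lintegral_mono_set
          apply Set.iUnion_subset
          rintro i _ ⟨t, ht, rfl⟩
          exact hmS i t ht.1
  refine le_trans ?_ hlen
  -- angular part
  set E' : Fin n → Set ℝ := fun i => E i ∩ {t | γ i t ∈ Complex.slitPlane} ∩
    {t | ‖γ i t‖ = R (γ i t).arg} with hE'
  have hargm : ∀ i, Measurable fun t => (γ i t).arg := fun i =>
    Complex.measurable_arg.comp (hc i).measurable
  have hE'm : ∀ i, MeasurableSet (E' i) := fun i =>
    ((hEm i).inter (Complex.isOpen_slitPlane.preimage (hc i)).measurableSet).inter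
      (measurableSet_eq_fun (hc i).norm.measurable (hR.comp (hargm i)))
  have hqm : ∀ i, Measurable fun t => deriv (γ i) t / γ i t := fun i =>
    (hcd i).measurable.div (hc i).measurable
  have hang : ∫⁻ θ in Set.Ioo (-π) π, ENNReal.ofReal (G (R θ)) ≤
      ∑ i, ∫⁻ t in E' i, ENNReal.ofReal |(deriv (γ i) t / γ i t).im| *
        ENNReal.ofReal (G (R (γ i t).arg)) := by
    apply setLIntegral_cover_le (f := fun i t => (γ i t).arg)
      (f' := fun i t => (deriv (γ i) t / γ i t).im) (H := fun θ => ENNReal.ofReal (G (R θ)))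
      hE'm hargm (fun i => Complex.measurable_im.comp (hqm i))
    · intro i t ht
      exact (hasDerivAt_arg_curve (hd i t) ht.1.2).hasDerivWithinAt
    · exact (hG.comp hR).ennreal_ofReal
    · intro θ hθ
      obtain ⟨z, hz, hzR, hza⟩ := hRS θ hθ
      obtain ⟨i, t, ht, rfl⟩ := hcov z hz
      refine Set.mem_iUnion.2 ⟨i, t, ⟨⟨ht, ?_⟩, ?_⟩, hza⟩
      · exact Complex.mem_slitPlane_iff_arg.2 ⟨by rw [hza]; exact hθ.2.ne, hne i t ht.1⟩
      · simp only [Set.mem_ofPred_eq, hza, hzR]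
  -- radial part
  have hρm : ∀ i, Measurable fun t => (deriv (γ i) t / γ i t).re * ‖γ i t‖ := fun i =>
    (Complex.measurable_re.comp (hqm i)).mul (hc i).norm.measurable
  have hrad : ∀ A : Fin n → Set ℝ, (∀ i, MeasurableSet (A i)) → (∀ i, A i ⊆ E i) →
      (∀ r ∈ Set.Ioo r0 Rm, ∃ i, ∃ t ∈ A i, ‖γ i t‖ = r) →
      ∫⁻ r in Set.Ioo r0 Rm, ENNReal.ofReal (k r) ≤
      ∑ i, ∫⁻ t in A i, ENNReal.ofReal |(deriv (γ i) t / γ i t).re * ‖γ i t‖| *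
        ENNReal.ofReal (k ‖γ i t‖) := by
    intro A hAm hAE hAcov
    apply setLIntegral_cover_le (f := fun i t => ‖γ i t‖)
      (f' := fun i t => (deriv (γ i) t / γ i t).re * ‖γ i t‖) (H := fun r => ENNReal.ofReal (k r))
      hAm (fun i => (hc i).norm.measurable) hρm
    · intro i t ht
      exact (hasDerivAt_norm_curve (hd i t) (hne i t (hAE i ht).1)).hasDerivWithinAt
    · exact hk.ennreal_ofReal
    · intro r hr
      obtain ⟨i, t, ht, h⟩ := hAcov r hr
      exact Set.mem_iUnion.2 ⟨i, t, ht, h⟩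
  have hrad1 := hrad F hFm hFE (by
    intro r hr
    obtain ⟨z, hz, -, -, -, hzr, -⟩ := htwo r hr
    obtain ⟨i, t, ht, rfl⟩ := hcov z hz
    obtain ⟨j, s, hs, hjs⟩ := firstTimes_exists (φ := fun i t => ‖γ i t‖)
      (fun i => (hc i).norm) (i := i) ht.1
    exact ⟨j, s, hs, hjs.trans hzr⟩)
  have hrad2 := hrad (fun i => E i \ F i) (fun i => (hEm i).diff (hFm i))
    (fun i => Set.sdiff_subset) (by
    intro r hr
    obtain ⟨z, hz, w, hw, hzw, hzr, hwr⟩ := htwo r hr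
    obtain ⟨i, t, ht, rfl⟩ := hcov z hz
    obtain ⟨j, s, hs, rfl⟩ := hcov w hw
    by_cases h1 : t ∈ F i
    · by_cases h2 : s ∈ F j
      · exfalso
        obtain ⟨rfl, rfl⟩ := firstTimes_unique h1 h2 (hzr.trans hwr.symm)
        exact hzw rfl
      · exact ⟨j, s, ⟨hs, h2⟩, hwr⟩
    · exact ⟨i, t, ⟨ht, h1⟩, hzr⟩)
  refine (add_le_add hang (show _ ≤ ∑ i, ∫⁻ t in E i,
      ENNReal.ofReal |(deriv (γ i) t / γ i t).re * ‖γ i t‖| *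
        ENNReal.ofReal (k ‖γ i t‖) from ?_)).trans ?_
  · rw [two_mul]
    refine (add_le_add hrad1 hrad2).trans (le_of_eq ?_)
    rw [← Finset.sum_add_distrib]
    refine Finset.sum_congr rfl fun i _ => ?_
    rw [← lintegral_union ((hEm i).diff (hFm i)) Set.disjoint_sdiff_right,
      Set.union_sdiff_cancel (hFE i)]
  rw [← Finset.sum_add_distrib]
  refine Finset.sum_le_sum fun i _ => ?_
  have hE'E : E' i = E' i ∩ E i := by
    rw [Set.inter_eq_left.2]; exact fun t ht => ht.1.1
  rw [hE'E, ← Measure.restrict_restrict (hE'm i), ← lintegral_indicator (hE'm i), ← lintegral_add_right]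
  · apply setLIntegral_mono' (hEm i)
    intro t ht
    have hz : γ i t ≠ 0 := hne i t ht.1
    have hρ : 0 < ‖γ i t‖ := norm_pos_iff.2 hz
    have hcs := cs_point (a := (deriv (γ i) t / γ i t).re) (b := (deriv (γ i) t / γ i t).im)
      hρ (hG0 ‖γ i t‖) (hk0 ‖γ i t‖) (hGk _ hρ)
    have hnorm : ‖γ i t‖ * √((deriv (γ i) t / γ i t).re ^ 2 + (deriv (γ i) t / γ i t).im ^ 2) =
        ‖deriv (γ i) t‖ := by
      rw [← Complex.norm_eq_sqrt_sq_add_sq, norm_div]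
      field_simp
    rw [hnorm] at hcs
    rw [hh]
    simp only
    rw [← ENNReal.ofReal_mul (by positivity), ← ENNReal.ofReal_mul (by positivity)]
    refine le_trans ?_ (ENNReal.ofReal_le_ofReal hcs)
    rw [ENNReal.ofReal_add (mul_nonneg (abs_nonneg _) (hG0 _)) (mul_nonneg (abs_nonneg _) (hk0 _))]
    gcongr
    by_cases ht' : t ∈ E' i
    · rw [Set.indicator_of_mem ht', ENNReal.ofReal_mul (abs_nonneg _)]
      have : ‖γ i t‖ = R (γ i t).arg := ht'.2
      rw [this]
    · rw [Set.indicator_of_notMem ht']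
      exact zero_le
  · exact ((hρm i).norm.ennreal_ofReal).mul ((hk.comp (hc i).norm.measurable).ennreal_ofReal)

lemma subset_of_disjoint_frontier {Ω C : Set ℂ} (hO : IsOpen Ω) (hC : IsPreconnected C)
    (hne : (C ∩ Ω).Nonempty) (hd : ∀ z ∈ C, z ∉ frontier Ω) : C ⊆ Ω := by
  apply hC.subset_left_of_subset_union hO (isClosed_closure (s := Ω)).isOpen_compl
    (Set.disjoint_compl_right_iff_subset.2 subset_closure) _ hne
  intro z hz
  by_cases h : z ∈ closure Ω
  · rw [closure_eq_self_union_frontier] at h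
    rcases h with h | h
    · exact Or.inl h
    · exact absurd h (hd z hz)
  · exact Or.inr h

/-- polar coordinates -/
noncomputable def polarPt (r θ : ℝ) : ℂ := (r : ℂ) * Complex.exp (θ * Complex.I)

lemma polarPt_continuous : Continuous fun x : ℝ × ℝ => polarPt x.1 x.2 := by
  unfold polarPt; fun_prop

lemma norm_polarPt (r θ : ℝ) : ‖polarPt r θ‖ = |r| := by
  simp [polarPt]

lemma polarPt_norm_arg (z : ℂ) : polarPt ‖z‖ z.arg = z := Complex.norm_mul_exp_arg_mul_I z

lemma arg_polarPt {r θ : ℝ} (hr : 0 < r) (hθ : θ ∈ Set.Ioo (-π) π) : (polarPt r θ).arg = θ := by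
  unfold polarPt
  rw [Complex.arg_real_mul _ hr, Complex.exp_mul_I,
    Complex.arg_cos_add_sin_mul_I ⟨hθ.1, hθ.2.le⟩]

lemma exit_point {Ω : Set ℂ} (hO : IsOpen Ω) (hb : Bornology.IsBounded Ω) {a θ : ℝ} (ha : 0 ≤ a)
    (hz : polarPt a θ ∈ Ω) : ∃ r, a < r ∧ polarPt r θ ∈ frontier Ω := by
  by_contra hcon
  push Not at hcon
  have hsub : (fun r => polarPt r θ) '' Set.Ici a ⊆ Ω := by
    apply subset_of_disjoint_frontier hO
    · apply isPreconnected_Ici.image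
      exact (polarPt_continuous.comp (by fun_prop : Continuous fun r : ℝ => (r, θ))).continuousOn
    · exact ⟨_, ⟨a, Set.self_mem_Ici, rfl⟩, hz⟩
    · rintro _ ⟨r, hr, rfl⟩ hfr
      rcases (Set.mem_Ici.1 hr).eq_or_lt with h | h
      · subst h
        rw [hO.frontier_eq] at hfr
        exact hfr.2 hz
      · exact hcon r h hfr
  obtain ⟨M, hM⟩ := hb.exists_norm_le
  have h1 := hM _ (hsub ⟨max a (M + 1), Set.mem_Ici.2 (le_max_left _ _), rfl⟩)
  simp only [norm_polarPt] at h1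
  have h2 := (le_max_right a (M + 1)).trans ((le_abs_self _).trans h1)
  linarith

lemma circle_closure {Ω : Set ℂ} (hO : IsOpen Ω) (hconn : IsPreconnected Ω) (h0 : (0 : ℂ) ∈ Ω)
    {r : ℝ} (hr : 0 < r) {y : ℂ} (hy : y ∈ frontier Ω) (hyr : r < ‖y‖)
    (hone : ¬ ∃ z ∈ frontier Ω, ∃ w ∈ frontier Ω, z ≠ w ∧ ‖z‖ = r ∧ ‖w‖ = r) (θ : ℝ) :
    polarPt r θ ∈ closure Ω := by
  have hnf : ∀ z ∈ Ω, z ∉ frontier Ω := fun z hz h => by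
    rw [hO.frontier_eq] at h; exact h.2 hz
  obtain ⟨u, hu1, hu2⟩ := mem_closure_iff.1 (frontier_subset_closure hy) {z | r < ‖z‖}
    (isOpen_lt continuous_const continuous_norm) hyr
  obtain ⟨z, hz, hzr⟩ := hconn.intermediate_value h0 hu2 continuous_norm.continuousOn
    (show r ∈ Set.Icc ‖(0 : ℂ)‖ ‖u‖ from ⟨by simpa using hr.le, le_of_lt hu1⟩)
  replace hzr : ‖z‖ = r := hzr
  have hw : ∃ w : ℂ, ‖w‖ = r ∧ z ≠ w ∧ ∀ x ∈ frontier Ω, ‖x‖ = r → x = w := by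
    by_cases h : ∃ w ∈ frontier Ω, ‖w‖ = r
    · obtain ⟨w, hw, hwr⟩ := h
      refine ⟨w, hwr, ?_, ?_⟩
      · rintro rfl; exact hnf _ hz hw
      · intro x hx hxr
        by_contra hne
        exact hone ⟨x, hx, w, hw, hne, hxr, hwr⟩
    · refine ⟨-z, by simpa using hzr, ?_, ?_⟩
      · intro hzz
        have : z = 0 := by
          have h2 : (2 : ℂ) * z = 0 := by linear_combination hzz
          simpa using h2
        rw [this, norm_zero] at hzr
        exact hr.ne hzr
      · intro x hx hxr
        exact absurd ⟨x, hx, hxr⟩ h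
  obtain ⟨w, hwr, hzw, hwS⟩ := hw
  set f : ℝ → ℂ := fun t => polarPt r t with hf
  have hfc : Continuous f := polarPt_continuous.comp (by fun_prop : Continuous fun t : ℝ => (r, t))
  have hper : Function.Periodic f (2 * π) := by
    intro t
    simp only [hf, polarPt]
    push_cast
    rw [add_mul, Complex.exp_add, Complex.exp_two_pi_mul_I, mul_one]
  set α := w.arg with hα
  have hwα : f α = w := by simp only [hf, hα, ← hwr]; exact polarPt_norm_arg w
  have hsub : f '' Set.Ioo α (α + 2 * π) ⊆ Ω := by
    apply subset_of_disjoint_frontier hO (isPreconnected_Ioo.image _ hfc.continuousOn)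
    · obtain ⟨t, ht, hzt⟩ := hper.exists_mem_Ico Real.two_pi_pos z.arg α
      have hfz : f z.arg = z := by
        simp only [hf, ← hzr]; exact polarPt_norm_arg z
      rw [hfz] at hzt
      refine ⟨z, ⟨t, ⟨lt_of_le_of_ne ht.1 ?_, ht.2⟩, hzt.symm⟩, hz⟩
      rintro h
      rw [← h, hwα] at hzt
      exact hzw hzt
    · rintro _ ⟨t, ht, rfl⟩ hfr
      have h1 := hwS _ hfr (by simp only [hf, norm_polarPt, abs_of_pos hr])
      rw [← hwα] at h1
      simp only [hf, polarPt] at h1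
      have hrc : (r : ℂ) ≠ 0 := by exact_mod_cast hr.ne'
      have h2 := mul_left_cancel₀ hrc h1
      have h3 : Complex.exp (((t - α : ℝ) : ℂ) * Complex.I) = 1 := by
        push_cast
        rw [sub_mul, Complex.exp_sub, h2, div_self (Complex.exp_ne_zero _)]
      have h4 : Real.cos (t - α) = 1 := by
        rw [← Complex.exp_ofReal_mul_I_re, h3, Complex.one_re]
      have h5 := (Real.cos_eq_one_iff_of_lt_of_lt (by linarith [ht.1, Real.pi_pos])
        (by linarith [ht.2])).1 h4
      linarith [ht.1]
  obtain ⟨t, ht, hθt⟩ := hper.exists_mem_Ico Real.two_pi_pos θ α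
  have : f θ ∈ closure (f '' Set.Ioo α (α + 2 * π)) := by
    rw [hθt]
    apply image_closure_subset_closure_image hfc
    rw [closure_Ioo (by linarith [Real.pi_pos])]
    exact ⟨t, ⟨ht.1, ht.2.le⟩, rfl⟩
  exact closure_mono hsub this

theorem radial_structure {Ω : Set ℂ} (hO : IsOpen Ω) (hb : Bornology.IsBounded Ω)
    (hconn : IsPreconnected Ω) (h0 : (0 : ℂ) ∈ Ω) :
    ∃ (R : ℝ → ℝ) (r0 Rm : ℝ), Measurable R ∧ 0 < r0 ∧ r0 ≤ Rm ∧ (∀ θ, r0 ≤ R θ ∧ R θ ≤ Rm) ∧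
      (∀ θ ∈ Set.Ioo (-π) π, ∃ z ∈ frontier Ω, ‖z‖ = R θ ∧ z.arg = θ) ∧
      (∀ r ∈ Set.Ioo r0 Rm, ∃ z ∈ frontier Ω, ∃ w ∈ frontier Ω, z ≠ w ∧ ‖z‖ = r ∧ ‖w‖ = r) ∧
      volume Ω ≤ ∫⁻ θ in Set.Ioo (-π) π, ENNReal.ofReal (R θ ^ 2 / 2) := by
  have hScl : IsClosed (frontier Ω) := isClosed_frontier
  have hSc : IsCompact (frontier Ω) :=
    Metric.isCompact_of_isClosed_isBounded hScl (hb.closure.subset frontier_subset_closure)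
  have hnf : ∀ z ∈ Ω, z ∉ frontier Ω := fun z hz h => by
    rw [hO.frontier_eq] at h; exact h.2 hz
  have hex : ∀ θ, ∃ r, 0 < r ∧ polarPt r θ ∈ frontier Ω := fun θ =>
    exit_point hO hb le_rfl (by simpa [polarPt] using h0)
  have hSne : (frontier Ω).Nonempty := let ⟨r, _, h⟩ := hex 0; ⟨_, h⟩
  obtain ⟨y, hyS, hymax⟩ := hSc.exists_isMaxOn hSne continuous_norm.continuousOn
  have hymax' : ∀ z ∈ frontier Ω, ‖z‖ ≤ ‖y‖ := fun z hz => hymax hz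
  set Rm := ‖y‖ with hRm
  set K : ℝ → Set ℝ := fun θ => {r | r ∈ Set.Icc 0 Rm ∧ polarPt r θ ∈ frontier Ω} with hK
  have hKc : ∀ θ, IsCompact (K θ) := by
    intro θ
    apply isCompact_Icc.inter_right
    exact hScl.preimage (polarPt_continuous.comp (by fun_prop : Continuous fun r : ℝ => (r, θ)))
  have hKmem : ∀ {θ r : ℝ}, 0 ≤ r → polarPt r θ ∈ frontier Ω → r ∈ K θ := by
    intro θ r hr h
    refine ⟨⟨hr, ?_⟩, h⟩
    have := hymax' _ h
    rwa [norm_polarPt, abs_of_nonneg hr] at this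
  have hKne : ∀ θ, (K θ).Nonempty := fun θ => by
    obtain ⟨r, hr, h⟩ := hex θ
    exact ⟨r, hKmem hr.le h⟩
  set R : ℝ → ℝ := fun θ => sSup (K θ) with hR
  have hRK : ∀ θ, R θ ∈ K θ := fun θ => (hKc θ).sSup_mem (hKne θ)
  have hleR : ∀ {θ r : ℝ}, r ∈ K θ → r ≤ R θ := fun {θ r} h => le_csSup (hKc θ).bddAbove h
  have hRpos : ∀ θ, 0 < R θ := fun θ => by
    obtain ⟨r, hr, h⟩ := hex θ
    exact hr.trans_le (hleR (hKmem hr.le h))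
  have hRmeas : Measurable R := by
    apply measurable_of_Ici
    intro a
    have : R ⁻¹' Set.Ici a = ⋃ m : ℕ, Prod.snd '' ((Set.Icc (max a 0) Rm ×ˢ
        Set.Icc (-(m : ℝ)) m) ∩ {x : ℝ × ℝ | polarPt x.1 x.2 ∈ frontier Ω}) := by
      ext θ
      simp only [Set.mem_preimage, Set.mem_Ici, Set.mem_iUnion, Set.mem_image]
      constructor
      · intro h
        obtain ⟨m, hm⟩ := exists_nat_ge |θ|
        exact ⟨m, (R θ, θ), ⟨⟨⟨max_le h (hRpos θ).le, (hRK θ).1.2⟩, abs_le.1 hm⟩, (hRK θ).2⟩, rfl⟩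
      · rintro ⟨m, ⟨r, θ'⟩, ⟨⟨hr, _⟩, hS⟩, rfl⟩
        have h1 : 0 ≤ r := (le_max_right _ _).trans hr.1
        have h2 : a ≤ r := (le_max_left _ _).trans hr.1
        exact h2.trans (hleR (hKmem h1 hS))
    rw [this]
    refine MeasurableSet.iUnion fun m => IsCompact.measurableSet ?_
    refine IsCompact.image ?_ continuous_snd
    exact (isCompact_Icc.prod isCompact_Icc).inter_right (hScl.preimage polarPt_continuous)
  set A : Set ℝ := {r | 0 < r ∧ r < Rm ∧
    ¬ ∃ z ∈ frontier Ω, ∃ w ∈ frontier Ω, z ≠ w ∧ ‖z‖ = r ∧ ‖w‖ = r} with hA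
  have hAne : ∃ r, r ∈ A := by
    obtain ⟨δ, hδ, hball⟩ := Metric.isOpen_iff.1 hO 0 h0
    have hδS : ∀ z ∈ frontier Ω, δ ≤ ‖z‖ := by
      intro z hz
      by_contra hlt
      exact hnf z (hball (by simpa using hlt)) hz
    refine ⟨δ / 2, by linarith, by linarith [hδS y hyS], ?_⟩
    rintro ⟨z, hz, -, -, -, hzr, -⟩
    linarith [hδS z hz]
  have hAbdd : BddAbove A := ⟨Rm, fun r hr => hr.2.1.le⟩
  have hAR : ∀ r ∈ A, ∀ θ, r ≤ R θ := by
    intro r hr θ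
    have h1 := circle_closure hO hconn h0 hr.1 hyS hr.2.1 hr.2.2 θ
    rw [closure_eq_self_union_frontier] at h1
    rcases h1 with h1 | h1
    · obtain ⟨s, hs, hsS⟩ := exit_point hO hb hr.1.le h1
      exact hs.le.trans (hleR (hKmem (hr.1.le.trans hs.le) hsS))
    · exact hleR (hKmem hr.1.le h1)
  refine ⟨R, sSup A, Rm, hRmeas, ?_, ?_, ?_, ?_, ?_, ?_⟩
  · obtain ⟨r, hr⟩ := hAne
    exact hr.1.trans_le (le_csSup hAbdd hr)
  · exact csSup_le hAne fun r hr => hr.2.1.le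
  · exact fun θ => ⟨csSup_le hAne fun r hr => hAR r hr θ, (hRK θ).1.2⟩
  · intro θ hθ
    refine ⟨polarPt (R θ) θ, (hRK θ).2, ?_, arg_polarPt (hRpos θ) hθ⟩
    rw [norm_polarPt, abs_of_pos (hRpos θ)]
  · intro r hr
    by_contra hcon
    obtain ⟨s, hs⟩ := hAne
    have : r ∈ A := ⟨hs.1.trans_le ((le_csSup hAbdd hs).trans hr.1.le), hr.2, hcon⟩
    exact absurd (le_csSup hAbdd this) (not_le.2 hr.1)
  · have hpm : Measurable fun x : ℝ × ℝ => polarPt x.1 x.2 := polarPt_continuous.measurable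
    have e1 : volume Ω = ∫⁻ x in Set.Ioi (0 : ℝ) ×ˢ Set.Ioo (-π) π,
        ENNReal.ofReal x.1 * Ω.indicator 1 (polarPt x.1 x.2) := by
      rw [← lintegral_indicator_one hO.measurableSet, ← Complex.lintegral_comp_polarCoord_symm,
        polarCoord_target]
      congr 1
      ext x
      rw [Complex.polarCoord_symm_apply, smul_eq_mul, polarPt, Complex.exp_mul_I]
      push_cast
      rfl
    rw [e1, Measure.volume_eq_prod, ← Measure.prod_restrict, lintegral_prod_symm]
    · apply setLIntegral_mono' measurableSet_Ioo
      intro θ _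
      have hle : ∫⁻ r in Set.Ioi (0 : ℝ), ENNReal.ofReal r * Ω.indicator 1 (polarPt r θ) ≤
          ∫⁻ r in Set.Ioc 0 (R θ), ENNReal.ofReal r := by
        rw [← lintegral_indicator measurableSet_Ioi, ← lintegral_indicator measurableSet_Ioc]
        apply lintegral_mono
        intro r
        by_cases hr : r ∈ Set.Ioi (0 : ℝ)
        · have hr' : 0 < r := hr
          rw [Set.indicator_of_mem hr]
          by_cases hΩ : polarPt r θ ∈ Ω
          · obtain ⟨s, hs, hsS⟩ := exit_point hO hb hr'.le hΩ
            have : r ∈ Set.Ioc 0 (R θ) :=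
              ⟨hr', hs.le.trans (hleR (hKmem (hr'.le.trans hs.le) hsS))⟩
            simp [Set.indicator_of_mem this, hΩ]
          · simp [hΩ]
        · rw [Set.indicator_of_notMem hr]; exact zero_le
      refine hle.trans (le_of_eq ?_)
      rw [← ofReal_integral_eq_lintegral_ofReal]
      · rw [← intervalIntegral.integral_of_le (hRpos θ).le, integral_id]
        simp
      · exact (continuous_id.integrableOn_Icc (a := (0 : ℝ)) (b := R θ)).mono_set
          Set.Ioc_subset_Icc_self
      · exact (ae_restrict_iff' measurableSet_Ioc).2 (Filter.Eventually.of_forall fun r hr => hr.1.le)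
    · apply Measurable.aemeasurable
      exact (measurable_fst.ennreal_ofReal).mul
        ((measurable_one.indicator hO.measurableSet).comp hpm)

lemma ofReal_integral_le {α : Type*} [MeasurableSpace α] {μ : Measure α} {f : α → ℝ}
    (hf : Integrable f μ) : ENNReal.ofReal (∫ x, f x ∂μ) ≤ ∫⁻ x, ENNReal.ofReal (f x) ∂μ := by
  apply ENNReal.ofReal_le_of_le_toReal
  rw [integral_eq_lintegral_pos_part_sub_lintegral_neg_part hf]
  linarith [ENNReal.toReal_nonneg (a := ∫⁻ x, ENNReal.ofReal (-f x) ∂μ)]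

theorem complex_main {p : ℝ} (hp : -1 ≤ p) {Ω : Set ℂ} (hO : IsOpen Ω)
    (hb : Bornology.IsBounded Ω) (hconn : IsPreconnected Ω) (h0 : (0 : ℂ) ∈ Ω) {n : ℕ}
    {γ : Fin n → ℝ → ℂ} (hγ : ∀ i, ContDiff ℝ 1 (γ i))
    (hS : frontier Ω = ⋃ i, γ i '' Set.Icc (0 : ℝ) 1) :
    ENNReal.ofReal (2 * π * ((volume Ω).toReal / π) ^ ((p + 1) / 2)) ≤
      ∫⁻ z in frontier Ω, ENNReal.ofReal (‖z‖ ^ p) ∂μH[1] := by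
  obtain ⟨R, r0, Rm, hRm, hr0, hr0R, hRb, hRS, htwo, hvol⟩ := radial_structure hO hb hconn h0
  have h0S : (0 : ℂ) ∉ frontier Ω := fun h => by rw [hO.frontier_eq] at h; exact h.2 h0
  set q := (p + 1) / 2 with hq
  have hq0 : 0 ≤ q := by rw [hq]; linarith
  have hpi := Real.pi_pos
  set L := ∫⁻ z in frontier Ω, ENNReal.ofReal (‖z‖ ^ p) ∂μH[1] with hL
  have hRpos : ∀ θ, 0 < R θ := fun θ => hr0.trans_le (hRb θ).1
  have hsq0 : ∀ θ, r0 ^ 2 ≤ R θ ^ 2 := fun θ => by gcongr; exact (hRb θ).1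
  have hsq1 : ∀ θ, R θ ^ 2 ≤ Rm ^ 2 := fun θ => by
    have := hRpos θ
    gcongr; exact (hRb θ).2
  have hIntegr : IntegrableOn (fun θ => R θ ^ 2) (Set.Ioo (-π) π) := by
    apply Measure.integrableOn_of_bounded (M := Rm ^ 2) (by simp)
    · refine Filter.Eventually.of_forall fun θ => ?_
      rw [Real.norm_of_nonneg (sq_nonneg _)]
      exact hsq1 θ
    · exact (hRm.pow_const 2).aestronglyMeasurable
  have hconst : ∀ b : ℝ, ∫ θ in Set.Ioo (-π) π, b = 2 * π * b := fun b => by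
    rw [setIntegral_const, Real.volume_real_Ioo_of_le (by linarith), smul_eq_mul]; ring
  set X := (∫ θ in Set.Ioo (-π) π, R θ ^ 2) / (2 * π) with hX
  have hXint : ∫ θ in Set.Ioo (-π) π, R θ ^ 2 = 2 * π * X := by rw [hX]; field_simp
  have hcint : ∀ b : ℝ, IntegrableOn (fun _ : ℝ => b) (Set.Ioo (-π) π) := fun b =>
    integrableOn_const (by simp)
  have hX0 : r0 ^ 2 ≤ X := by
    rw [hX, le_div_iff₀ (by positivity), mul_comm, ← hconst]
    exact setIntegral_mono (hcint _) hIntegr hsq0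
  have hX1 : X ≤ Rm ^ 2 := by
    rw [hX, div_le_iff₀ (by positivity), mul_comm, ← hconst]
    exact setIntegral_mono hIntegr (hcint _) hsq1
  have hXpos : 0 < X := lt_of_lt_of_le (by positivity) hX0
  have hVX : (volume Ω).toReal / π ≤ X := by
    rw [div_le_iff₀ hpi]
    apply ENNReal.toReal_le_of_le_ofReal (by positivity)
    refine hvol.trans (le_of_eq ?_)
    rw [← ofReal_integral_eq_lintegral_ofReal (hIntegr.div_const 2)
      (Filter.Eventually.of_forall fun θ => by positivity), integral_div, hXint]
    congr 1
    ring
  have havg : ∀ (a b : ℝ) (G : ℝ → ℝ), (∀ θ, a * R θ ^ 2 + b ≤ G (R θ)) →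
      ENNReal.ofReal (2 * π * (a * X + b)) ≤
        ∫⁻ θ in Set.Ioo (-π) π, ENNReal.ofReal (G (R θ)) := by
    intro a b G hG
    have h1 : ∫ θ in Set.Ioo (-π) π, (a * R θ ^ 2 + b) = 2 * π * (a * X + b) := by
      rw [integral_add (hIntegr.const_mul a) (hcint b), integral_const_mul, hXint, hconst]
      ring
    rw [← h1]
    refine (ofReal_integral_le ((hIntegr.const_mul a).add (hcint b))).trans ?_
    exact lintegral_mono fun θ => ENNReal.ofReal_le_ofReal (hG θ)
  have hpow : ∀ r : ℝ, 0 < r → (r ^ 2) ^ q / r = r ^ p := by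
    intro r hr
    rw [← Real.rpow_natCast_mul hr.le, div_eq_iff hr.ne', ← Real.rpow_add_one hr.ne', hq]
    congr 1
    push_cast
    ring
  have hqm : Measurable fun r : ℝ => (r ^ 2) ^ q := by fun_prop
  suffices hmain : ENNReal.ofReal (2 * π * X ^ q) ≤ L by
    refine le_trans (ENNReal.ofReal_le_ofReal ?_) hmain
    gcongr
  -- the convex type cases
  have hcase : ∀ m : ℝ, (∀ θ, X ^ q + m * (R θ ^ 2 - X) ≤ (R θ ^ 2) ^ q) →
      ENNReal.ofReal (2 * π * X ^ q) ≤ L := by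
    intro m hm
    have h1 := havg m (X ^ q - m * X) (fun r => (r ^ 2) ^ q) (fun θ => by linarith [hm θ])
    have h2 := geometric_bound hγ hS h0S (p := p) hRm hRS htwo (G := fun r => (r ^ 2) ^ q)
      (k := fun _ => 0) hqm measurable_const (fun r => by positivity) (fun _ => le_rfl)
      (fun r hr => by rw [hpow r hr]; simp)
    simp only [ENNReal.ofReal_zero, lintegral_zero, mul_zero, add_zero] at h2
    refine le_trans (le_of_eq ?_) (h1.trans h2)
    congr 1
    ring
  rcases hq0.eq_or_lt with hqz | hqpos
  · exact hcase 0 fun θ => by simp [← hqz]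
  rcases le_or_gt 1 q with hq1 | hq1
  · apply hcase (q * (X ^ q / X))
    intro θ
    have hx : 0 < R θ ^ 2 := by have := hRpos θ; positivity
    set x := R θ ^ 2 with hxd
    have h1 := one_add_mul_self_le_rpow_one_add (s := x / X - 1) (by
      have : 0 < x / X := by positivity
      linarith) hq1
    have h2 : 1 + (x / X - 1) = x / X := by ring
    rw [h2, Real.div_rpow hx.le hXpos.le, le_div_iff₀ (by positivity)] at h1
    refine le_trans (le_of_eq ?_) h1
    field_simp
  rcases hr0R.eq_or_lt with hrr | hrr
  · apply hcase 0
    intro θ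
    have h1 : X = R θ ^ 2 := by
      have := hsq0 θ
      have := hsq1 θ
      rw [← hrr] at this hX1
      linarith
    rw [h1]; simp
  -- the concave case
  have hRm0 : 0 < Rm := hr0.trans hrr
  have hx01 : r0 ^ 2 < Rm ^ 2 := by gcongr
  set c := ((Rm ^ 2) ^ q - (r0 ^ 2) ^ q) / (Rm ^ 2 - r0 ^ 2) with hc
  set d := (r0 ^ 2) ^ q - c * r0 ^ 2 with hd
  have hcpos : 0 < c := by
    apply div_pos _ (by linarith)
    have := Real.rpow_lt_rpow (by positivity) hx01 hqpos
    linarith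
  have e0 : c * r0 ^ 2 + d = (r0 ^ 2) ^ q := by rw [hd]; ring
  have e1 : c * Rm ^ 2 + d = (Rm ^ 2) ^ q := by
    have : c * (Rm ^ 2 - r0 ^ 2) = (Rm ^ 2) ^ q - (r0 ^ 2) ^ q := by
      rw [hc]; field_simp [(sub_pos.2 hx01).ne']
    linarith
  have hd0 : 0 ≤ d := by
    have h1 : (Rm ^ 2) ^ (q - 1) ≤ (r0 ^ 2) ^ (q - 1) :=
      Real.rpow_le_rpow_of_nonpos (by positivity) hx01.le (by linarith)
    rw [Real.rpow_sub_one (by positivity), Real.rpow_sub_one (by positivity),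
      div_le_div_iff₀ (by positivity) (by positivity), ← e0, ← e1] at h1
    have h2 : 0 ≤ d * (Rm ^ 2 - r0 ^ 2) := by nlinarith
    exact nonneg_of_mul_nonneg_left h2 (by linarith)
  classical
  set G : ℝ → ℝ := (Set.Icc r0 Rm).indicator fun r => c * r ^ 2 + d with hG
  set k : ℝ → ℝ := (Set.Ioo r0 Rm).indicator
    fun r => √(((r ^ 2) ^ q) ^ 2 - (c * r ^ 2 + d) ^ 2) / r with hk
  have hGm : Measurable G := Measurable.indicator (by fun_prop) measurableSet_Icc
  have hkm : Measurable k := Measurable.indicator (by fun_prop) measurableSet_Ioo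
  have hG0 : ∀ r, 0 ≤ G r := fun r => Set.indicator_nonneg (fun r _ => by positivity) r
  have hk0 : ∀ r, 0 ≤ k r := fun r => Set.indicator_nonneg (fun r hr => by
    have : 0 < r := hr0.trans hr.1
    positivity) r
  have hGk : ∀ r, 0 < r → (G r / r) ^ 2 + (k r) ^ 2 ≤ (r ^ p) ^ 2 := by
    intro r hr
    rw [← hpow r hr]
    by_cases h1 : r ∈ Set.Ioo r0 Rm
    · rw [hG, hk, Set.indicator_of_mem h1, Set.indicator_of_mem (Set.Ioo_subset_Icc_self h1)]
      have hlt := chord_lt hqpos hq1 (sq_nonneg r0) (x := r ^ 2) (by have := h1.1; gcongr)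
        (by have := h1.2; gcongr) e0 e1
      have hnn : 0 ≤ c * r ^ 2 + d := by positivity
      rw [div_pow, div_pow, Real.sq_sqrt (by nlinarith), div_pow, ← add_div]
      apply le_of_eq
      congr 1
      ring
    · rw [hk, Set.indicator_of_notMem h1]
      by_cases h2 : r ∈ Set.Icc r0 Rm
      · rw [hG, Set.indicator_of_mem h2]
        have h3 : r = r0 ∨ r = Rm := by
          by_contra hcon
          push Not at hcon
          exact h1 ⟨lt_of_le_of_ne h2.1 (Ne.symm hcon.1), lt_of_le_of_ne h2.2 hcon.2⟩
        rcases h3 with h3 | h3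
        · rw [h3, e0]; simp
        · rw [h3, e1]; simp
      · rw [hG, Set.indicator_of_notMem h2]
        simp only [zero_div, ne_eq, OfNat.ofNat_ne_zero, not_false_eq_true, zero_pow, add_zero]
        positivity
  have h1 := geometric_bound hγ hS h0S (p := p) hRm hRS htwo hGm hkm hG0 hk0 hGk
  have h2 := havg c d G fun θ => by
    rw [hG, Set.indicator_of_mem (show R θ ∈ Set.Icc r0 Rm from hRb θ)]
  have h3 := I_bound hr0 hrr hqpos hq1 hcpos hd0 e0 e1 hX0 hX1
  have h4 : ∫⁻ r in Set.Ioo r0 Rm, ENNReal.ofReal (k r) = ∫⁻ r in Set.Ioo r0 Rm,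
      ENNReal.ofReal (√(((r ^ 2) ^ q) ^ 2 - (c * r ^ 2 + d) ^ 2) / r) := by
    apply setLIntegral_congr_fun measurableSet_Ioo
    intro r hr
    simp only [hk, Set.indicator_of_mem hr]
  rw [h4] at h1
  refine le_trans ?_ h1
  have h5 : 2 * π * X ^ q = 2 * π * (c * X + d) +
      (π * (X ^ q - (c * X + d)) + π * (X ^ q - (c * X + d))) := by ring
  rw [h5, two_mul (∫⁻ r in Set.Ioo r0 Rm, _)]
  refine ENNReal.ofReal_add_le.trans (add_le_add h2 ?_)
  exact ENNReal.ofReal_add_le.trans (add_le_add h3 h3)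

/-- Theorem 2.1 (i): weighted isoperimetric inequality for connected domains
containing the origin, for `p ≥ -1`. -/
theorem weighted_isoperimetric_connected
    (p : ℝ) (hp : -1 ≤ p)
    (Ω : Set (EuclideanSpace ℝ (Fin 2)))
    (hopen : IsOpen Ω) (hbdd : Bornology.IsBounded Ω)
    (hconn : IsConnected Ω)
    (hbry : HasPiecewiseC1Boundary Ω)
    (h0 : (0 : EuclideanSpace ℝ (Fin 2)) ∈ Ω) :
    ((volume Ω).toReal / π) ^ ((p + 1) / 2) ≤
      (1 / (2 * π)) * ∫ x in frontier Ω, ‖x‖ ^ p ∂μH[1] := by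
  obtain ⟨n, γ, hγ, hS⟩ := hbry
  have hpi := Real.pi_pos
  have h0S : (0 : EuclideanSpace ℝ (Fin 2)) ∉ frontier Ω := fun h => by
    rw [hopen.frontier_eq] at h; exact h.2 h0
  set e : ℂ ≃ₗᵢ[ℝ] EuclideanSpace ℝ (Fin 2) := Complex.orthonormalBasisOneI.repr with he
  have hfr : frontier (e ⁻¹' Ω) = e ⁻¹' frontier Ω :=
    (e.toHomeomorph.preimage_frontier Ω).symm
  have hpre : ∀ s : Set (EuclideanSpace ℝ (Fin 2)), e ⁻¹' s = e.symm '' s := fun s =>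
    (e.toEquiv.image_symm_eq_preimage s).symm
  have hmain := complex_main hp (Ω := e ⁻¹' Ω) (hopen.preimage e.continuous)
    (by rw [hpre]; exact e.symm.lipschitz.isBounded_image hbdd)
    (by rw [hpre]; exact hconn.isPreconnected.image _ e.symm.continuous.continuousOn)
    (by simpa using h0) (γ := fun i t => e.symm (γ i t))
    (fun i => e.symm.contDiff.comp (hγ i))
    (by rw [hfr, hS, hpre, Set.image_iUnion]; simp only [Set.image_image])
  have hvol : volume (e ⁻¹' Ω) = volume Ω :=
    e.measurePreserving.measure_preimage hopen.measurableSet.nullMeasurableSet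
  have hlint : ∫⁻ z in e ⁻¹' frontier Ω, ENNReal.ofReal (‖z‖ ^ p) ∂μH[1] =
      ∫⁻ x in frontier Ω, ENNReal.ofReal (‖x‖ ^ p) ∂μH[1] := by
    have h1 := (e.toIsometryEquiv.measurePreserving_hausdorffMeasure 1).setLIntegral_comp_preimage_emb
      e.toHomeomorph.measurableEmbedding (fun x => ENNReal.ofReal (‖x‖ ^ p)) (frontier Ω)
    rw [← h1]
    apply lintegral_congr
    intro z
    exact congrArg (fun s : ℝ => ENNReal.ofReal (s ^ p)) (e.norm_map z).symm
  rw [hfr, hvol, hlint] at hmain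
  have hSc : IsCompact (frontier Ω) :=
    Metric.isCompact_of_isClosed_isBounded isClosed_frontier
      (hbdd.closure.subset frontier_subset_closure)
  have hfinS : μH[1] (frontier Ω) < ⊤ := by
    rw [hS]
    refine (measure_iUnion_le _).trans_lt ?_
    rw [tsum_fintype]
    refine ENNReal.sum_lt_top.2 fun i _ => ?_
    obtain ⟨K, hK⟩ := (hγ i).contDiffOn.exists_lipschitzOnWith one_ne_zero
      (convex_Icc (0 : ℝ) 1) isCompact_Icc
    refine (hK.hausdorffMeasure_image_le zero_le_one).trans_lt ?_
    rw [hausdorffMeasure_real]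
    simp
  have hcont : ContinuousOn (fun x : EuclideanSpace ℝ (Fin 2) => ‖x‖ ^ p) (frontier Ω) := by
    intro x hx
    apply ContinuousAt.continuousWithinAt
    apply continuous_norm.continuousAt.rpow_const
    left
    rw [norm_ne_zero_iff]
    rintro rfl
    exact h0S hx
  obtain ⟨M, hM⟩ := hSc.exists_bound_of_continuousOn hcont
  have hfin : ∫⁻ x in frontier Ω, ENNReal.ofReal (‖x‖ ^ p) ∂μH[1] < ⊤ := by
    refine (setLIntegral_mono' (g := fun _ => ENNReal.ofReal M) isClosed_frontier.measurableSet
      fun x hx => ?_).trans_lt ?_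
    · exact ENNReal.ofReal_le_ofReal ((le_abs_self _).trans (hM x hx))
    · rw [setLIntegral_const]
      exact ENNReal.mul_lt_top ENNReal.ofReal_lt_top hfinS
  have hbo : ∫ x in frontier Ω, ‖x‖ ^ p ∂μH[1] =
      (∫⁻ x in frontier Ω, ENNReal.ofReal (‖x‖ ^ p) ∂μH[1]).toReal := by
    apply integral_eq_lintegral_of_nonneg_ae
    · exact Filter.Eventually.of_forall fun x => by positivity
    · apply Measurable.aestronglyMeasurable
      fun_prop
  rw [ENNReal.ofReal_le_iff_le_toReal hfin.ne, ← hbo] at hmain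
  rw [one_div, ← div_eq_inv_mul, le_div_iff₀ (by positivity)]
  linarith
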